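/- For every natural number n ≥ 1, the expected number of comparisons of randomized QuickSort on n distinct elements satisfies E(t_n) ≤ 2·n·ln(n), where E(t_n) = ∑_{x ∈ Q_n} q_n(x) · t_n(x). -/

import Mathlib

/-- Runs of QuickSort, encoded as trees: `node k a b` is a run whose first
splitter has rank `k` (within the current input), with recursive runs `a` on
the `k - 1` smaller elements and `b` on the remaining larger elements. -/
inductive Run : Type where
  | leaf : Run
  | node : ℕ → Run → Run → Run
deriving DecidableEq

/-- The sample space `Q n` of runs of QuickSort on `n` elements:
`Q 0 = Q 1 = {⊥}` and, for `n ≥ 2`,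
`Q n = ⋃_{k ∈ {1,…,n}} {k} × (Q (k-1) × Q (n-k))`. -/
def runs : ℕ → Finset Run
  | 0 => {Run.leaf}
  | 1 => {Run.leaf}
  | n + 2 =>
    (Finset.univ : Finset (Fin (n + 2))).biUnion fun k =>
      ((runs k.val) ×ˢ (runs (n + 1 - k.val))).image fun p =>
        Run.node (k.val + 1) p.1 p.2
decreasing_by
  · exact k.isLt.trans_le (Nat.le_refl _)
  · omega

/-- The probability `q n` of a run of QuickSort on `n` elements:
`q n ⊥ = 1` and `q n (k, (a, b)) = (1 / n) * q (k - 1) a * q (n - k) b`. -/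
noncomputable def qv : ℕ → Run → ℝ
  | _, Run.leaf => 1
  | n, Run.node k a b => (1 / (n : ℝ)) * qv (k - 1) a * qv (n - k) b

/-- The number of comparisons `t n` of a run of QuickSort on `n` elements:
`t n ⊥ = 0` and `t n (k, (a, b)) = (n - 1) + t (k - 1) a + t (n - k) b`. -/
noncomputable def tv : ℕ → Run → ℝ
  | _, Run.leaf => 0
  | n, Run.node k a b => ((n : ℝ) - 1) + tv (k - 1) a + tv (n - k) b

theorem sum_runs_add_two (n : ℕ) (F : Run → ℝ) :
    ∑ x ∈ runs (n + 2), F x = ∑ k ∈ Finset.range (n + 2),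
      ∑ a ∈ runs k, ∑ b ∈ runs (n + 1 - k), F (Run.node (k + 1) a b) := by
  rw [runs, Finset.sum_biUnion, Finset.sum_range]
  · refine Finset.sum_congr rfl fun k _ => ?_
    rw [Finset.sum_image, Finset.sum_product]
    rintro ⟨a, b⟩ _ ⟨c, d⟩ _ h
    simpa using h
  · intro i _ j _ hij
    simp only [Function.onFun, Finset.disjoint_left, Finset.mem_image]
    rintro x ⟨p, -, rfl⟩ ⟨r, -, h⟩
    simp only [Run.node.injEq] at h
    exact hij (Fin.ext (by omega))

theorem sum_qv_eq_one (n : ℕ) : ∑ x ∈ runs n, qv n x = 1 := by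
  induction n using Nat.strong_induction_on with
  | _ n ih =>
    match n with
    | 0 => simp [runs, qv]
    | 1 => simp [runs, qv]
    | n + 2 =>
      rw [sum_runs_add_two]
      have hsum : ∀ k ∈ Finset.range (n + 2),
          ∑ a ∈ runs k, ∑ b ∈ runs (n + 1 - k), qv (n + 2) (Run.node (k + 1) a b)
            = 1 / ((n + 2 : ℕ) : ℝ) := by
        intro k hk
        have hk' := Finset.mem_range.mp hk
        simp only [qv, Nat.add_sub_cancel, show n + 2 - (k + 1) = n + 1 - k by omega,
          ← Finset.mul_sum, ih (n + 1 - k) (by omega), ih k hk', mul_one]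
      rw [Finset.sum_congr rfl hsum, Finset.sum_const, Finset.card_range, nsmul_eq_mul]
      field_simp

/-- The expected number of comparisons of QuickSort on `n` elements. -/
noncomputable def expectedComparisons (n : ℕ) : ℝ := ∑ x ∈ runs n, qv n x * tv n x

theorem expectedComparisons_add_two (n : ℕ) :
    expectedComparisons (n + 2) = (n + 1) +
      2 / ((n : ℝ) + 2) * ∑ k ∈ Finset.range (n + 2), expectedComparisons k := by
  have hsum : ∀ k ∈ Finset.range (n + 2),
      ∑ a ∈ runs k, ∑ b ∈ runs (n + 1 - k),
        qv (n + 2) (Run.node (k + 1) a b) * tv (n + 2) (Run.node (k + 1) a b)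
        = 1 / ((n : ℝ) + 2) *
          ((n + 1) + expectedComparisons k + expectedComparisons (n + 1 - k)) := by
    intro k hk
    have hsplit : ∀ a b : Run,
        qv (n + 2) (Run.node (k + 1) a b) * tv (n + 2) (Run.node (k + 1) a b)
        = 1 / ((n : ℝ) + 2) * ((n + 1) * (qv k a * qv (n + 1 - k) b)
          + (qv k a * tv k a) * qv (n + 1 - k) b
          + qv k a * (qv (n + 1 - k) b * tv (n + 1 - k) b)) := by
      intro a b
      simp only [qv, tv, Nat.add_sub_cancel, show n + 2 - (k + 1) = n + 1 - k by omega]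
      push_cast
      ring
    simp only [hsplit, Finset.sum_add_distrib, ← Finset.mul_sum, ← Finset.sum_mul,
      sum_qv_eq_one, expectedComparisons, mul_one, one_mul]
  have hreflect := Finset.sum_range_reflect expectedComparisons (n + 2)
  simp only [show n + 2 - 1 = n + 1 by omega] at hreflect
  rw [expectedComparisons, sum_runs_add_two, Finset.sum_congr rfl hsum, ← Finset.mul_sum,
    Finset.sum_add_distrib, Finset.sum_add_distrib, hreflect, Finset.sum_const,
    Finset.card_range, nsmul_eq_mul]
  push_cast
  field_simp
  ring

theorem sum_range_two_mul_log_le (n : ℕ) (hn : 1 ≤ n) :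
    ∑ k ∈ Finset.range n, 2 * (k : ℝ) * Real.log k
      ≤ (n : ℝ) ^ 2 * Real.log n - (n : ℝ) ^ 2 / 2 + 1 / 2 := by
  induction n, hn using Nat.le_induction with
  | base => simp
  | succ n hn ih =>
    rw [Finset.sum_range_succ]
    have hn' : (1 : ℝ) ≤ n := by exact_mod_cast hn
    have hlog : 1 / ((n : ℝ) + 1) ≤ Real.log (n + 1) - Real.log n := by
      rw [← Real.log_div (by positivity) (by positivity)]
      refine le_trans (le_of_eq ?_) (Real.one_sub_inv_le_log_of_pos (by positivity))
      field_simp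
      ring
    have hmul : (n : ℝ) + 1 ≤ ((n : ℝ) + 1) ^ 2 * (Real.log (n + 1) - Real.log n) := by
      refine le_trans (le_of_eq ?_) (mul_le_mul_of_nonneg_left hlog (by positivity))
      field_simp
    have hnonneg := Real.log_nonneg hn'
    push_cast
    linarith

theorem expectedComparisons_le (n : ℕ) :
    expectedComparisons n ≤ 2 * (n : ℝ) * Real.log n := by
  induction n using Nat.strong_induction_on with
  | _ n ih =>
    match n with
    | 0 => simp [expectedComparisons, runs, tv]
    | 1 => simp [expectedComparisons, runs, tv]
    | n + 2 =>
      have hsum := (Finset.sum_le_sum fun k hk => ih k (Finset.mem_range.mp hk)).trans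
        (sum_range_two_mul_log_le (n + 2) (by omega))
      rw [expectedComparisons_add_two]
      push_cast at hsum ⊢
      calc _ ≤ ((n : ℝ) + 1) + 2 / ((n : ℝ) + 2) *
            (((n : ℝ) + 2) ^ 2 * Real.log (n + 2) - ((n : ℝ) + 2) ^ 2 / 2 + 1 / 2) := by
            gcongr
        _ = 2 * ((n : ℝ) + 2) * Real.log (n + 2) - (1 - 1 / ((n : ℝ) + 2)) := by
            field_simp
            ring
        _ ≤ _ := by
            have : 1 / ((n : ℝ) + 2) ≤ 1 := by
              rw [div_le_one (by positivity)]
              linarith [(n.cast_nonneg : (0 : ℝ) ≤ n)]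
            linarith

/-- For every `n ≥ 1`, the expected number of comparisons of
randomized QuickSort on `n` distinct elements satisfies
`E (t n) = ∑_{x ∈ Q n} q n x * t n x ≤ 2 * n * ln n`. -/
theorem quicksort_expected_comparisons_le (n : ℕ) (hn : 1 ≤ n) :
    ∑ x ∈ runs n, qv n x * tv n x ≤ 2 * (n : ℝ) * Real.log n :=
  expectedComparisons_le n
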